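/- (Characterization of coördinated Jeffrey conditionalization) Let p_y, p*_z, p*_x be probability functions and B₁, …, Bₙ formulas such that {B₁, …, Bₙ} behaves as a partition under p*_z (p*_z(Bᵢ∧Bⱼ) = 0 for i ≠ j and p*_z(B₁∨…∨Bₙ) = 1), p*_z(Bᵢ) > 0 and p_y(Bᵢ) > 0 for each i, and p_y(Bᵢ∧Bⱼ) = p*_z(Bᵢ∧Bⱼ) for i ≠ j. Then p*_x(A) = Σᵢ p_y(A|Bᵢ)·p*_z(Bᵢ) for all formulas A if and only if all of the following hold: (i) p*_x(Bᵢ) = p*_z(Bᵢ) for each i; (ii) for all A and each i, p*_x(A|Bᵢ) = p_y(A|Bᵢ); (iii) {B₁, …, Bₙ} behaves as a partition under p*_x. -/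

import Mathlib

inductive PFormula (α : Type) : Type
  | atom : α → PFormula α
  | neg : PFormula α → PFormula α
  | conj : PFormula α → PFormula α → PFormula α
  | disj : PFormula α → PFormula α → PFormula α

/-- A Dunn–Belnap valuation: each formula gets a subset of {T, F}. -/
structure DBValuation (α : Type) : Type where
  vT : PFormula α → Prop
  vF : PFormula α → Prop
  negT : ∀ A, vT A.neg ↔ vF A
  negF : ∀ A, vF A.neg ↔ vT A
  conjT : ∀ A B, vT (A.conj B) ↔ (vT A ∧ vT B)
  conjF : ∀ A B, vF (A.conj B) ↔ (vF A ∨ vF B)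
  disjT : ∀ A B, vT (A.disj B) ↔ (vT A ∨ vT B)
  disjF : ∀ A B, vF (A.disj B) ↔ (vF A ∧ vF B)

def Entails {α : Type} (A B : PFormula α) : Prop :=
  ∀ v : DBValuation α, v.vT A → v.vT B

/-- A (generalized) probability function over Dunn–Belnap logic. -/
structure ProbFun (α : Type) : Type where
  p : PFormula α → ℝ
  nonneg : ∀ A, 0 ≤ p A
  le_one : ∀ A, p A ≤ 1
  mono : ∀ A B, Entails A B → p A ≤ p B
  add : ∀ A B, p (A.conj B) + p (A.disj B) = p A + p B

/-- Conditional probability `p(A|B) = p(A∧B)/p(B)` (0 when `p(B) = 0`,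
by the Lean convention on division by zero). -/
noncomputable def ProbFun.cond {α : Type} (P : ProbFun α) (A B : PFormula α) : ℝ :=
  P.p (A.conj B) / P.p B

/-- Disjunction of a nonempty finite family `C 0 ∨ … ∨ C n`. -/
def disjFam {α : Type} : (n : ℕ) → (Fin (n + 1) → PFormula α) → PFormula α
  | 0, C => C 0
  | n + 1, C => (disjFam n (fun i => C i.castSucc)).disj (C (Fin.last (n + 1)))

namespace ProbFun

variable {α : Type} (P : ProbFun α)

theorem congr_of_vT_iff {A B : PFormula α} (h : ∀ v : DBValuation α, v.vT A ↔ v.vT B) :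
    P.p A = P.p B :=
  le_antisymm (P.mono _ _ fun v => (h v).1) (P.mono _ _ fun v => (h v).2)

theorem eq_zero_of_entails {A B : PFormula α} (h : Entails A B) (hB : P.p B = 0) :
    P.p A = 0 :=
  le_antisymm (hB ▸ P.mono _ _ h) (P.nonneg A)

theorem conj_eq_left {A B : PFormula α} (h : Entails A B) : P.p (A.conj B) = P.p A :=
  P.congr_of_vT_iff fun v => by
    rw [v.conjT]
    exact and_iff_left_of_imp (h v)

theorem conj_comm (A B : PFormula α) : P.p (A.conj B) = P.p (B.conj A) :=
  P.congr_of_vT_iff fun v => by rw [v.conjT, v.conjT, and_comm]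

theorem conj_eq_of_eq_one (A : PFormula α) {D : PFormula α} (hD : P.p D = 1) :
    P.p (A.conj D) = P.p A := by
  have h : P.p D ≤ P.p (A.disj D) := P.mono _ _ fun v hv => (v.disjT A D).2 (Or.inr hv)
  linarith [P.add A D, P.le_one (A.disj D)]

theorem conj_disj_of_conj_eq_zero (A : PFormula α) {C D : PFormula α}
    (h : P.p (C.conj D) = 0) :
    P.p (A.conj (C.disj D)) = P.p (A.conj C) + P.p (A.conj D) := by
  have h_overlap : P.p ((A.conj C).conj (A.conj D)) = 0 :=
    P.eq_zero_of_entails (fun v => by simp only [v.conjT]; tauto) h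
  have h_distrib : P.p (A.conj (C.disj D)) = P.p ((A.conj C).disj (A.conj D)) :=
    P.congr_of_vT_iff fun v => by simp only [v.conjT, v.disjT]; tauto
  linarith [P.add (A.conj C) (A.conj D)]

end ProbFun

theorem entails_disjFam {α : Type} {n : ℕ} (C : Fin (n + 1) → PFormula α) (i : Fin (n + 1)) :
    Entails (C i) (disjFam n C) := by
  induction n with
  | zero => rw [Fin.fin_one_eq_zero i]; exact fun _ h => h
  | succ n ih =>
    intro v hv
    refine (v.disjT _ _).2 ?_
    induction i using Fin.lastCases with
    | last => exact Or.inr hv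
    | cast i => exact Or.inl (ih (fun i => C i.castSucc) i v hv)

namespace ProbFun

variable {α : Type} (P : ProbFun α)

theorem conj_disjFam (A : PFormula α) {n : ℕ} (C : Fin (n + 1) → PFormula α)
    (hC : ∀ i j, i ≠ j → P.p ((C i).conj (C j)) = 0) :
    P.p (A.conj (disjFam n C)) = ∑ i, P.p (A.conj (C i)) := by
  induction n generalizing A with
  | zero => simp [disjFam]
  | succ n ih =>
    have disj_prev : ∀ i j : Fin (n + 1), i ≠ j →
        P.p ((C i.castSucc).conj (C j.castSucc)) = 0 := fun i j hij =>
      hC _ _ fun h => hij (Fin.castSucc_injective _ h)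
    have disj_last :
        P.p ((disjFam n fun i => C i.castSucc).conj (C (Fin.last (n + 1)))) = 0 := by
      rw [P.conj_comm, ih _ _ disj_prev]
      exact Finset.sum_eq_zero fun i _ => hC _ _ (Fin.castSucc_lt_last i).ne'
    rw [disjFam, P.conj_disj_of_conj_eq_zero A disj_last, ih _ _ disj_prev,
      Fin.sum_univ_castSucc (n := n + 1)]

theorem disjFam_eq_sum {n : ℕ} (C : Fin (n + 1) → PFormula α)
    (hC : ∀ i j, i ≠ j → P.p ((C i).conj (C j)) = 0) :
    P.p (disjFam n C) = ∑ i, P.p (C i) := by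
  rw [← P.conj_eq_left (A := disjFam n C) fun _ h => h, P.conj_disjFam _ C hC]
  exact Finset.sum_congr rfl fun i _ => by
    rw [P.conj_comm, P.conj_eq_left (entails_disjFam C i)]

theorem cond_eq_one {A B : PFormula α} (hB : 0 < P.p B) (h : Entails B A) :
    P.cond A B = 1 := by
  rw [cond, P.conj_comm, P.conj_eq_left h, div_self hB.ne']

theorem cond_eq_zero {A B C : PFormula α} (h : Entails A C) (hCB : P.p (C.conj B) = 0) :
    P.cond A B = 0 := by
  rw [cond, P.eq_zero_of_entails (fun v => ?_) hCB, zero_div]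
  simp only [v.conjT]
  exact And.imp_left (h v)

end ProbFun

theorem coordinated_jeffrey_conditionalization {α : Type}
    (py pzs pxs : ProbFun α) (n : ℕ) (B : Fin (n + 1) → PFormula α)
    (hdisj : ∀ i j : Fin (n + 1), i ≠ j → pzs.p ((B i).conj (B j)) = 0)
    (hcover : pzs.p (disjFam n B) = 1)
    (hzpos : ∀ i : Fin (n + 1), 0 < pzs.p (B i))
    (hypos : ∀ i : Fin (n + 1), 0 < py.p (B i))
    (hyz : ∀ i j : Fin (n + 1), i ≠ j → py.p ((B i).conj (B j)) = pzs.p ((B i).conj (B j))) :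
    (∀ A : PFormula α, pxs.p A = ∑ i : Fin (n + 1), py.cond A (B i) * pzs.p (B i)) ↔
      ((∀ i : Fin (n + 1), pxs.p (B i) = pzs.p (B i)) ∧
       (∀ (A : PFormula α) (i : Fin (n + 1)), pxs.cond A (B i) = py.cond A (B i)) ∧
       ((∀ i j : Fin (n + 1), i ≠ j → pxs.p ((B i).conj (B j)) = 0) ∧
        pxs.p (disjFam n B) = 1)) := by
  have hy : ∀ i j, i ≠ j → py.p ((B i).conj (B j)) = 0 := fun i j hij =>
    (hyz i j hij).trans (hdisj i j hij)
  constructor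
  · intro hx
    have single : ∀ (A : PFormula α) (j : Fin (n + 1)), Entails A (B j) →
        pxs.p A = py.cond A (B j) * pzs.p (B j) := by
      intro A j hA
      rw [hx, Finset.sum_eq_single_of_mem j (Finset.mem_univ j)]
      intro i _ hij
      rw [py.cond_eq_zero hA (hy j i hij.symm), zero_mul]
    have hB : ∀ i, pxs.p (B i) = pzs.p (B i) := fun i => by
      rw [single _ i fun _ h => h, py.cond_eq_one (hypos i) fun _ h => h, one_mul]
    refine ⟨hB, fun A i => ?_, fun i j hij => ?_, ?_⟩
    · have h : py.cond (A.conj (B i)) (B i) = py.cond A (B i) := by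
        rw [ProbFun.cond, ProbFun.cond, py.conj_eq_left fun v hv => ((v.conjT _ _).1 hv).2]
      rw [ProbFun.cond, hB, single _ i fun v hv => ((v.conjT _ _).1 hv).2, h,
        mul_div_cancel_right₀ _ (hzpos i).ne']
    · rw [single _ j fun v hv => ((v.conjT _ _).1 hv).2,
        py.cond_eq_zero (fun v hv => ((v.conjT _ _).1 hv).1) (hy i j hij), zero_mul]
    · rw [hx, ← hcover, pzs.disjFam_eq_sum B hdisj]
      exact Finset.sum_congr rfl fun i _ => by
        rw [py.cond_eq_one (hypos i) (entails_disjFam B i), one_mul]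
  · rintro ⟨hB, hcond, hxdisj, hxcover⟩ A
    rw [← pxs.conj_eq_of_eq_one A hxcover, pxs.conj_disjFam A B hxdisj]
    refine Finset.sum_congr rfl fun i _ => ?_
    rw [← hcond, ← hB, ProbFun.cond, div_mul_cancel₀]
    rw [hB]
    exact (hzpos i).ne'
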